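/- Let ℓ > 0 and μ ∈ ℝ, set τ := 2πi/ℓ, assume θ₃(μ;τ) ≠ 0, and set w_μ := 1/2 − μ + τ/2. Then g_μ(w_μ) = 0 and for every w ∈ ℂ with w ∉ ℤ + τℤ and w_μ − w ∉ ℤ + τℤ one has g_μ(w)·g_μ(w_μ − w) = −(2/(πi))·g_μ′(w_μ), where g_μ′ denotes the complex derivative of g_μ. -/

import Mathlib

open Complex

noncomputable section

/-- Jacobi theta function `θ₁(w;τ)` with nome `q = exp(iπτ)`. -/
def theta1 (τ w : ℂ) : ℂ :=
  -Complex.I * ∑' n : ℤ, (-1 : ℂ) ^ n *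
    Complex.exp (Real.pi * Complex.I * τ * ((n : ℂ) + 1 / 2) ^ 2) *
    Complex.exp ((2 * (n : ℂ) + 1) * Real.pi * Complex.I * w)

/-- Jacobi theta function `θ₃(w;τ)` with nome `q = exp(iπτ)`. -/
def theta3 (τ w : ℂ) : ℂ :=
  ∑' n : ℤ, Complex.exp (Real.pi * Complex.I * τ * (n : ℂ) ^ 2) *
    Complex.exp (2 * Real.pi * Complex.I * (n : ℂ) * w)

/-- The modulus `τ = 2πi/ℓ`. -/
def tau (ℓ : ℝ) : ℂ := 2 * Real.pi * Complex.I / (ℓ : ℂ)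

/-- The function `g_μ(w) = (2/(πi))·θ₁′(0;τ)·θ₃(w+μ;τ)/(θ₃(μ;τ)·θ₁(w;τ))` with `τ = 2πi/ℓ`. -/
def gmu (ℓ μ : ℝ) (w : ℂ) : ℂ :=
  2 / (Real.pi * Complex.I) * deriv (theta1 (tau ℓ)) 0 * theta3 (tau ℓ) (w + (μ : ℂ)) /
    (theta3 (tau ℓ) (μ : ℂ) * theta1 (tau ℓ) w)

/-- The function `f_μ(z) = ℓ⁻¹ g_μ(z/ℓ)`. -/
def fmu (ℓ μ : ℝ) (z : ℂ) : ℂ := (ℓ : ℂ)⁻¹ * gmu ℓ μ (z / (ℓ : ℂ))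

/-- The lattice `{m ω₁ + n ω₂ : m, n ∈ ℤ}`. -/
def lat (ω₁ ω₂ : ℂ) : Set ℂ := {z : ℂ | ∃ m n : ℤ, z = (m : ℂ) * ω₁ + (n : ℂ) * ω₂}

/-- The Weierstrass `℘`-function for the lattice spanned by `ω₁, ω₂`:
`℘(z) = z⁻² + ∑_{ω ∈ Λ∖{0}} ((z−ω)⁻² − ω⁻²)`. -/
def wp (ω₁ ω₂ : ℂ) (z : ℂ) : ℂ :=
  1 / z ^ 2 + ∑' p : {p : ℤ × ℤ // p ≠ 0},
    (1 / (z - ((p.1.1 : ℂ) * ω₁ + (p.1.2 : ℂ) * ω₂)) ^ 2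
      - 1 / ((p.1.1 : ℂ) * ω₁ + (p.1.2 : ℂ) * ω₂) ^ 2)

/-- The point `z_μ = (1/2 − μ)ℓ + πi`. -/
def zmu (ℓ μ : ℝ) : ℂ := (1 / 2 - (μ : ℂ)) * (ℓ : ℂ) + Real.pi * Complex.I

open scoped Classical in
/-- The cycle sum `∑_{σ ∈ Cₙ} ∏_{k=1}^n f(z_{σ(k)} − z_k)`, where `Cₙ` is the set of
permutations of `{1,…,n}` consisting of a single `n`-cycle. -/
def cycleSum (n : ℕ) (f : ℂ → ℂ) (z : Fin n → ℂ) : ℂ :=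
  ∑ σ ∈ Finset.univ.filter
      (fun σ : Equiv.Perm (Fin n) => σ.IsCycle ∧ σ.support = Finset.univ),
    ∏ k : Fin n, f (z (σ k) - z k)

/-- The open horizontal strip `S = {0 < Im z < π}`. -/
def strip : Set ℂ := {z : ℂ | 0 < z.im ∧ z.im < Real.pi}

/-- The top substrip `S_ε = {π − ε < Im z < π}`. -/
def topStrip (ε : ℝ) : Set ℂ := {z : ℂ | Real.pi - ε < z.im ∧ z.im < Real.pi}

end

lemma aux_half (y : ℝ) (hy : 1 ≤ y) (z : ℂ) (hz : |z.im| ≤ y / 2)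
    (h0 : jacobiTheta₂ (z + (1 / 2 + (y * I) / 2)) (y * I) = 0) : ∃ m : ℤ, z = m := by
  by_contra hne
  have hu : 1 - cexp (-(2 * Real.pi * I * z)) ≠ 0 := by
    intro h
    have h1 : cexp (-(2 * Real.pi * I * z)) = 1 := by linear_combination -h
    obtain ⟨n, hn⟩ := Complex.exp_eq_one_iff.1 h1
    apply hne
    refine ⟨-n, ?_⟩
    have hpi : (2 * Real.pi * I : ℂ) ≠ 0 := Complex.two_pi_I_ne_zero
    apply mul_left_cancel₀ hpi
    push_cast
    linear_combination -hn
  have him : 0 < ((y : ℂ) * I).im := by simp; linarith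
  have hs := hasSum_jacobiTheta₂_term (z + (1 / 2 + (y * I) / 2)) him
  rw [h0] at hs
  have hs2 := hs.nat_add_neg_add_one
  set a : ℕ → ℂ := fun n => (-1) ^ n * cexp (-Real.pi * y * (n ^ 2 + n)) *
    ∑ k ∈ Finset.range (2 * n + 1), cexp (2 * Real.pi * I * ((k : ℂ) - n) * z) with ha
  have hterm : ∀ m : ℤ, jacobiTheta₂_term m (z + (1 / 2 + (y * I) / 2)) (y * I) =
      (-1) ^ m * cexp (-Real.pi * y * (m ^ 2 + m)) * cexp (2 * Real.pi * I * m * z) := by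
    intro m
    have : ((-1 : ℂ)) ^ m = cexp (m * (Real.pi * I)) := by
      rw [Complex.exp_int_mul, Complex.exp_pi_mul_I]
    rw [this, jacobiTheta₂_term, ← Complex.exp_add, ← Complex.exp_add]
    congr 1
    linear_combination (Real.pi * y * (m ^ 2 + m) : ℂ) * Complex.I_sq
  have hfac : ∀ n : ℕ, jacobiTheta₂_term n (z + (1 / 2 + (y * I) / 2)) (y * I) +
      jacobiTheta₂_term (-(n + 1)) (z + (1 / 2 + (y * I) / 2)) (y * I) =
      (1 - cexp (-(2 * Real.pi * I * z))) * a n := by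
    intro n
    rw [hterm, hterm, ha]
    have e1 : ((-1 : ℂ)) ^ (-((n : ℤ) + 1)) = - (-1) ^ n := by
      rw [zpow_neg, zpow_add₀ (by norm_num), zpow_natCast]
      rcases neg_one_pow_eq_or ℂ n with h | h <;> rw [h] <;> norm_num
    rw [e1, zpow_natCast]
    have e2 : ((-((n : ℤ) + 1) : ℤ) : ℂ) ^ 2 + ((-((n : ℤ) + 1) : ℤ) : ℂ) = (n : ℂ) ^ 2 + n := by
      push_cast; ring
    rw [e2]
    have e3 : (1 - cexp (-(2 * Real.pi * I * z))) *
        ∑ k ∈ Finset.range (2 * n + 1), cexp (2 * Real.pi * I * ((k : ℂ) - n) * z) =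
        cexp (2 * Real.pi * I * n * z) - cexp (2 * Real.pi * I * (-((n : ℂ) + 1)) * z) := by
      rw [Finset.mul_sum]
      have : ∀ k ∈ Finset.range (2 * n + 1), (1 - cexp (-(2 * Real.pi * I * z))) *
          cexp (2 * Real.pi * I * ((k : ℂ) - n) * z) =
          (fun j : ℕ => cexp (2 * Real.pi * I * ((j : ℂ) - n - 1) * z)) (k + 1) -
          (fun j : ℕ => cexp (2 * Real.pi * I * ((j : ℂ) - n - 1) * z)) k := by
        intro k _
        simp only
        rw [sub_mul, one_mul, ← Complex.exp_add]
        congr 2 <;> (push_cast; ring)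
      rw [Finset.sum_congr rfl this,
        Finset.sum_range_sub (fun j : ℕ => cexp (2 * Real.pi * I * ((j : ℂ) - n - 1) * z))]
      congr 2 <;> (push_cast; ring)
    push_cast at e3 ⊢
    linear_combination (-(-1) ^ n * cexp (-Real.pi * y * (n ^ 2 + n))) * e3
  simp_rw [hfac] at hs2
  have hs3 : HasSum a 0 := by
    have := hs2.mul_left (1 - cexp (-(2 * Real.pi * I * z)))⁻¹
    simpa [← mul_assoc, inv_mul_cancel₀ hu] using this
  have ha0 : a 0 = 1 := by simp [ha]
  have hs4 : HasSum (fun n => a (n + 1)) (-1) := by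
    have := (hasSum_nat_add_iff' 1).2 hs3
    simpa [ha0] using this
  have hq : Real.exp (-Real.pi * y) ≤ 1 / 12 := by
    have h1 : Real.exp (-Real.pi * y) ≤ Real.exp (-3) := by
      apply Real.exp_le_exp.2
      nlinarith [Real.pi_gt_three]
    have h2 : Real.exp (-3) = (Real.exp 1 ^ 3)⁻¹ := by
      rw [Real.exp_neg, ← Real.exp_nat_mul]; norm_num
    have h3 : (12 : ℝ) ≤ Real.exp 1 ^ 3 := by
      have h4 : (2.5 : ℝ) ≤ Real.exp 1 := by linarith [Real.exp_one_gt_d9]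
      calc (12 : ℝ) ≤ 2.5 ^ 3 := by norm_num
        _ ≤ _ := by gcongr
    rw [h2] at h1
    refine h1.trans ?_
    rw [one_div]
    exact inv_anti₀ (by norm_num) h3
  have hbound : ∀ n : ℕ, ‖a n‖ ≤ (1 / 4 : ℝ) ^ n := by
    intro n
    have b1 : ‖∑ k ∈ Finset.range (2 * n + 1), cexp (2 * Real.pi * I * ((k : ℂ) - n) * z)‖ ≤
        (2 * n + 1) * Real.exp (Real.pi * y * n) := by
      refine (norm_sum_le _ _).trans ?_
      refine (Finset.sum_le_card_nsmul _ _ (Real.exp (Real.pi * y * n)) ?_).trans ?_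
      · intro k hk
        rw [Complex.norm_exp]
        apply Real.exp_le_exp.2
        have hre : (2 * Real.pi * I * ((k : ℂ) - n) * z).re =
            2 * Real.pi * (-(((k : ℝ) - n) * z.im)) := by
          simp; ring
        rw [hre]
        have hk' : |(k : ℝ) - n| ≤ n := by
          have : k ≤ 2 * n := by simpa [Nat.lt_succ_iff] using hk
          have : (k : ℝ) ≤ 2 * n := by exact_mod_cast this
          rw [abs_le]; constructor
          · linarith [(Nat.cast_nonneg k : (0 : ℝ) ≤ k)]
          · linarith
        have : -(((k : ℝ) - n) * z.im) ≤ n * (y / 2) := by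
          refine (neg_le_abs _).trans ?_
          rw [abs_mul]
          gcongr
        nlinarith [Real.pi_pos]
      · simp
    have b2 : ‖a n‖ ≤ Real.exp (-Real.pi * y * (n ^ 2 + n)) *
        ((2 * n + 1) * Real.exp (Real.pi * y * n)) := by
      rw [ha]
      simp only [norm_mul, norm_pow, norm_neg, norm_one, one_pow, one_mul]
      have : ‖cexp (-Real.pi * y * (n ^ 2 + n))‖ = Real.exp (-Real.pi * y * (n ^ 2 + n)) := by
        rw [Complex.norm_exp]
        congr 1
        have : (-Real.pi * y * (n ^ 2 + n) : ℂ) = ((-Real.pi * y * (n ^ 2 + n) : ℝ) : ℂ) := by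
          push_cast; ring
        rw [this, Complex.ofReal_re]
      rw [this]
      gcongr
    have b3 : Real.exp (-Real.pi * y * (n ^ 2 + n)) *
        ((2 * n + 1) * Real.exp (Real.pi * y * n)) =
        (2 * n + 1) * Real.exp (-Real.pi * y * n ^ 2) := by
      rw [mul_left_comm, ← Real.exp_add]
      congr 2; ring
    have b4 : Real.exp (-Real.pi * y * n ^ 2) ≤ (1 / 12) ^ n := by
      calc Real.exp (-Real.pi * y * n ^ 2) ≤ Real.exp (n * (-Real.pi * y)) := by
            apply Real.exp_le_exp.2
            have : (n : ℝ) ≤ n ^ 2 := by exact_mod_cast Nat.le_self_pow (by norm_num) n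
            have hp : 0 < Real.pi * y := by positivity
            nlinarith
        _ = Real.exp (-Real.pi * y) ^ n := Real.exp_nat_mul _ _
        _ ≤ _ := by gcongr
    have b5 : (2 * n + 1 : ℝ) ≤ 3 ^ n := by
      have := one_add_mul_le_pow (a := (2 : ℝ)) (by norm_num) n
      norm_num at this
      linarith
    calc ‖a n‖ ≤ _ := b2
      _ = _ := b3
      _ ≤ 3 ^ n * (1 / 12) ^ n := by gcongr
      _ = _ := by rw [← mul_pow]; norm_num
  have hg : HasSum (fun n : ℕ => (1 / 4 : ℝ) ^ (n + 1)) (1 / 3) := by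
    have := (hasSum_geometric_of_lt_one (r := (1 / 4 : ℝ)) (by norm_num) (by norm_num)).mul_left (1 / 4 : ℝ)
    have e1 : (fun n : ℕ => (1 / 4 : ℝ) ^ (n + 1)) = fun i : ℕ => (1 / 4 : ℝ) * (1 / 4 : ℝ) ^ i := by
      funext n
      exact pow_succ' _ _
    have e2 : (1 / 3 : ℝ) = 1 / 4 * (1 - 1 / 4)⁻¹ := by norm_num
    rw [e1, e2]
    exact this
  have := hs4.norm_le_of_bounded hg (fun n => hbound (n + 1))
  norm_num at this

lemma aux_shift (τ z : ℂ) (n : ℤ) : jacobiTheta₂ (z + n * τ) τ = 0 ↔ jacobiTheta₂ z τ = 0 := by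
  have step : ∀ z, jacobiTheta₂ (z + τ) τ = 0 ↔ jacobiTheta₂ z τ = 0 := by
    intro z
    rw [jacobiTheta₂_add_left']
    simp [Complex.exp_ne_zero]
  induction n with
  | zero => simp
  | succ i ih =>
    refine Iff.trans ?_ ih
    rw [← step (z + ((i : ℤ) : ℂ) * τ)]
    push_cast; ring_nf
  | pred i ih =>
    refine Iff.trans ?_ ih
    rw [← step]
    push_cast; ring_nf

lemma aux_big (y : ℝ) (hy : 1 ≤ y) (z : ℂ)
    (h0 : jacobiTheta₂ (z + (1 / 2 + (y * I) / 2)) (y * I) = 0) :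
    ∃ m n : ℤ, z = m + n * (y * I) := by
  set n : ℤ := round (z.im / y)
  have hy0 : 0 < y := by linarith
  have h1 : jacobiTheta₂ ((z - n * (y * I)) + (1 / 2 + (y * I) / 2)) (y * I) = 0 := by
    rw [← aux_shift _ _ n, ← h0]
    congr 1; ring
  obtain ⟨m, hm⟩ := aux_half y hy _ (by
    have h2 := abs_sub_round (z.im / y)
    have h3 : (z - n * (y * I)).im = (z.im / y - n) * y := by
      simp; field_simp
    rw [h3, abs_mul, abs_of_pos hy0]
    nlinarith) h1
  exact ⟨m, n, by linear_combination hm⟩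

lemma aux_all (y : ℝ) (hy : 0 < y) (z : ℂ)
    (h0 : jacobiTheta₂ (z + (1 / 2 + (y * I) / 2)) (y * I) = 0) :
    ∃ m n : ℤ, z = m + n * (y * I) := by
  rcases le_total 1 y with h | h
  · exact aux_big y h z h0
  have hyc : (y : ℂ) ≠ 0 := by exact_mod_cast hy.ne'
  have hI := Complex.I_ne_zero
  rw [jacobiTheta₂_functional_equation] at h0
  have hc : (1 : ℂ) / (-I * (y * I)) ^ (1 / 2 : ℂ) ≠ 0 := by
    have : -I * (y * I) = (y : ℂ) := by linear_combination (-y : ℂ) * Complex.I_sq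
    rw [this]
    apply one_div_ne_zero
    rw [Complex.cpow_def_of_ne_zero hyc]
    exact Complex.exp_ne_zero _
  have h1 := (mul_eq_zero.1 h0).resolve_left (mul_ne_zero hc (Complex.exp_ne_zero _))
  have hinv : (-1 : ℂ) / (y * I) = ((y⁻¹ : ℝ) : ℂ) * I := by
    push_cast; field_simp; simp
  have hinv2 : (((y⁻¹ : ℝ) : ℂ) * I) * (y * I) = -1 := by
    rw [← hinv]; field_simp
  rw [hinv] at h1
  set t : ℂ := ((y⁻¹ : ℝ) : ℂ) * I with ht
  have harg : (z + (1 / 2 + (y * I) / 2)) / (y * I) = (z / (y * I) - t) + (1 / 2 + t / 2) := by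
    rw [← hinv]; field_simp; ring
  rw [harg] at h1
  obtain ⟨m, n, hmn⟩ := aux_big y⁻¹ ((one_le_inv₀ hy).2 h) _ h1
  refine ⟨-(n + 1), m, ?_⟩
  have hz : z = (z / (y * I)) * (y * I) := by field_simp
  rw [← ht] at hmn
  push_cast
  linear_combination hz + (y * I) * hmn + (n + 1) * hinv2

lemma theta3_eq (τ w : ℂ) : theta3 τ w = jacobiTheta₂ w τ := by
  unfold theta3 jacobiTheta₂ jacobiTheta₂_term
  refine tsum_congr fun n => ?_
  rw [← Complex.exp_add]; congr 1; ring

lemma theta1_eq (τ w : ℂ) : theta1 τ w =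
    -I * cexp (Real.pi * I * τ / 4 + Real.pi * I * w) * jacobiTheta₂ (w + (1 / 2 + τ / 2)) τ := by
  unfold theta1 jacobiTheta₂ jacobiTheta₂_term
  rw [mul_assoc (-I) (cexp _)]
  congr 1
  refine Eq.trans ?_ tsum_mul_left
  refine tsum_congr fun n => ?_
  have : ((-1 : ℂ)) ^ n = cexp (n * (Real.pi * I)) := by
    rw [Complex.exp_int_mul, Complex.exp_pi_mul_I]
  rw [this, ← Complex.exp_add, ← Complex.exp_add, ← Complex.exp_add]; congr 1; ring

lemma aux_refl (τ u : ℂ) : jacobiTheta₂ (2 * (1 / 2 + τ / 2) - u) τ =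
    cexp (-Real.pi * I * τ + 2 * Real.pi * I * u) * jacobiTheta₂ u τ := by
  have : 2 * (1 / 2 + τ / 2) - u = (-u + τ) + 1 := by ring
  rw [this, jacobiTheta₂_add_left, jacobiTheta₂_add_left', jacobiTheta₂_neg_left]
  congr 2; ring

lemma aux_c (τ : ℂ) : jacobiTheta₂ (1 / 2 + τ / 2) τ = 0 := by
  have h := aux_refl τ (1 / 2 + τ / 2)
  have e : cexp (-Real.pi * I * τ + 2 * Real.pi * I * (1 / 2 + τ / 2)) = -1 := by
    rw [← Complex.exp_pi_mul_I]; congr 1; ring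
  rw [e] at h
  have e2 : 2 * (1 / 2 + τ / 2) - (1 / 2 + τ / 2) = 1 / 2 + τ / 2 := by ring
  rw [e2] at h
  linear_combination h / 2

/-- `g_μ(w_μ) = 0` and `g_μ(w)·g_μ(w_μ−w) = −(2/(πi))·g_μ′(w_μ)` where
`w_μ = 1/2 − μ + τ/2`. -/
theorem stmt5 (ℓ μ : ℝ) (hℓ : 0 < ℓ)
    (hμ : theta3 (tau ℓ) (μ : ℂ) ≠ 0) :
    gmu ℓ μ ((1 : ℂ) / 2 - (μ : ℂ) + tau ℓ / 2) = 0 ∧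
    ∀ w : ℂ, w ∉ lat 1 (tau ℓ) →
      ((1 : ℂ) / 2 - (μ : ℂ) + tau ℓ / 2) - w ∉ lat 1 (tau ℓ) →
      gmu ℓ μ w * gmu ℓ μ (((1 : ℂ) / 2 - (μ : ℂ) + tau ℓ / 2) - w) =
        -(2 / (Real.pi * Complex.I)) * deriv (gmu ℓ μ) ((1 : ℂ) / 2 - (μ : ℂ) + tau ℓ / 2) := by
  have hty : tau ℓ = ((2 * Real.pi / ℓ : ℝ) : ℂ) * I := by
    unfold tau; push_cast; ring
  have hy : 0 < 2 * Real.pi / ℓ := by positivity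
  have him : 0 < (tau ℓ).im := by
    rw [hty, Complex.im_ofReal_mul, Complex.I_im, mul_one]; exact hy
  have hnz : ∀ z : ℂ, z ∉ lat 1 (tau ℓ) →
      jacobiTheta₂ (z + (1 / 2 + tau ℓ / 2)) (tau ℓ) ≠ 0 := by
    intro z hz h0
    apply hz
    rw [hty] at h0
    obtain ⟨m, n, h⟩ := aux_all _ hy z h0
    exact ⟨m, n, by rw [hty, h]; ring⟩
  rw [theta3_eq] at hμ
  set τ := tau ℓ with hτ
  have hg : gmu ℓ μ = fun w => 2 / (Real.pi * I) * deriv (theta1 τ) 0 * jacobiTheta₂ (w + μ) τ /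
    (jacobiTheta₂ μ τ * theta1 τ w) := by
    ext w; unfold gmu; rw [theta3_eq, theta3_eq]
  set c : ℂ := 1 / 2 + τ / 2 with hc
  have hwc : (1 : ℂ) / 2 - μ + τ / 2 = c - μ := by rw [hc]; ring
  rw [hwc]
  have hTc : jacobiTheta₂ c τ = 0 := aux_c τ
  refine ⟨by rw [hg]; simp [hTc], ?_⟩
  intro w hw hw'
  have hT : ∀ z, HasDerivAt (fun z => jacobiTheta₂ z τ) (jacobiTheta₂' z τ) z :=
    fun z => hasDerivAt_jacobiTheta₂_fst z him
  have hT' : ∀ z b, HasDerivAt (fun z => jacobiTheta₂ (z + b) τ) (jacobiTheta₂' (z + b) τ) z :=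
    fun z b => (hT (z + b)).comp_add_const z b
  set D := jacobiTheta₂' c τ with hD
  set E : ℂ → ℂ := fun v => -I * cexp (Real.pi * I * τ / 4 + Real.pi * I * v) with hE
  have hE0 : ∀ v, E v ≠ 0 := fun v =>
    mul_ne_zero (neg_ne_zero.2 Complex.I_ne_zero) (Complex.exp_ne_zero _)
  have hEd : Differentiable ℂ E := by rw [hE]; fun_prop
  have h1 : theta1 τ = fun v => E v * jacobiTheta₂ (v + c) τ := by
    ext v; exact theta1_eq τ v
  have hd1 : ∀ v, DifferentiableAt ℂ (theta1 τ) v := by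
    intro v; rw [h1]; exact (hEd v).mul (hT' v c).differentiableAt
  have hd0 : deriv (theta1 τ) 0 = E 0 * D := by
    rw [h1]
    refine Eq.trans ((hEd 0).hasDerivAt.mul (hT' 0 c)).deriv ?_
    simp [hTc, hD]
  have hrefl : ∀ u, jacobiTheta₂ (2 * c - u) τ =
    cexp (-Real.pi * I * τ + 2 * Real.pi * I * u) * jacobiTheta₂ u τ := fun u => aux_refl τ u
  have hθw : theta1 τ w = E w * (cexp (-Real.pi * I * τ + 2 * Real.pi * I * (c - w)) *
      jacobiTheta₂ (c - w) τ) := by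
    rw [h1, ← hrefl]; ring_nf
  have hθ : ∀ u, theta1 τ (c - u) = E (c - u) *
      (cexp (-Real.pi * I * τ + 2 * Real.pi * I * u) * jacobiTheta₂ u τ) := by
    intro u; rw [h1, ← hrefl]; ring_nf
  have hn1 : jacobiTheta₂ (c - w) τ ≠ 0 := by
    intro h
    apply hnz w hw
    have := hrefl (c - w)
    rw [h, mul_zero] at this
    rw [← this]; congr 1; ring
  have hn2 : jacobiTheta₂ (w + μ) τ ≠ 0 := by
    intro h
    apply hnz _ hw'
    have := hrefl (w + μ)
    rw [h, mul_zero] at this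
    rw [← this]; congr 1; ring
  have hθμ : theta1 τ (c - μ) ≠ 0 := by
    rw [hθ]; exact mul_ne_zero (hE0 _) (mul_ne_zero (Complex.exp_ne_zero _) hμ)
  have hgd : deriv (gmu ℓ μ) (c - μ) =
      2 / (Real.pi * I) * (E 0 * D) * D / (jacobiTheta₂ μ τ * theta1 τ (c - μ)) := by
    rw [hg]
    have hnum := (hT' (c - μ) μ).const_mul (2 / (Real.pi * I) * deriv (theta1 τ) 0)
    have hden := (hd1 (c - μ)).hasDerivAt.const_mul (jacobiTheta₂ μ τ)
    have := (hnum.div hden (mul_ne_zero hμ hθμ)).deriv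
    refine Eq.trans this ?_
    rw [sub_add_cancel, hTc, ← hD, hd0]
    field_simp
    ring
  have hcw : c - μ - w = c - (w + μ) := by ring
  have hgw : gmu ℓ μ w = 2 / (Real.pi * I) * (E 0 * D) * jacobiTheta₂ (w + μ) τ /
      (jacobiTheta₂ μ τ * theta1 τ w) := by rw [hg, hd0]
  have hgw' : gmu ℓ μ (c - μ - w) = 2 / (Real.pi * I) * (E 0 * D) * jacobiTheta₂ (c - w) τ /
      (jacobiTheta₂ μ τ * theta1 τ (c - (w + μ))) := by
    rw [hg, hd0, hcw]
    simp only
    congr 3; ring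
  have hkey : E 0 * (E (c - μ) * cexp (-Real.pi * I * τ + 2 * Real.pi * I * μ)) =
      -(E w * cexp (-Real.pi * I * τ + 2 * Real.pi * I * (c - w)) *
        (E (c - (w + μ)) * cexp (-Real.pi * I * τ + 2 * Real.pi * I * (w + μ)))) := by
    have e : ∀ x y p r : ℂ, (-I * cexp x) * cexp y * ((-I * cexp p) * cexp r) =
        -cexp (x + y + p + r) := by
      intro x y p r
      rw [Complex.exp_add, Complex.exp_add, Complex.exp_add]
      linear_combination (cexp x * cexp y * cexp p * cexp r) * Complex.I_sq
    have e' : E 0 * (E (c - μ) * cexp (-Real.pi * I * τ + 2 * Real.pi * I * μ)) =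
      E 0 * cexp 0 * (E (c - μ) * cexp (-Real.pi * I * τ + 2 * Real.pi * I * μ)) := by simp
    rw [e']
    simp only [hE]
    rw [e, e]
    congr 1
    rw [← neg_one_mul (cexp _), ← Complex.exp_pi_mul_I, ← Complex.exp_add,
      Complex.exp_eq_exp_iff_exists_int]
    refine ⟨-1, ?_⟩
    rw [hc]; push_cast; ring
  rw [hgw, hgw', hgd, hθw, hθ, hθ]
  have x1 := Complex.exp_ne_zero (-Real.pi * I * τ + 2 * Real.pi * I * μ)
  have x2 := Complex.exp_ne_zero (-Real.pi * I * τ + 2 * Real.pi * I * (c - w))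
  have x3 := Complex.exp_ne_zero (-Real.pi * I * τ + 2 * Real.pi * I * (w + μ))
  have y0 := hE0 0
  have y1 := hE0 (c - μ)
  have y2 := hE0 w
  have y3 := hE0 (c - (w + μ))
  generalize cexp (-Real.pi * I * τ + 2 * Real.pi * I * μ) = X1 at *
  generalize cexp (-Real.pi * I * τ + 2 * Real.pi * I * (c - w)) = X2 at *
  generalize cexp (-Real.pi * I * τ + 2 * Real.pi * I * (w + μ)) = X3 at *
  generalize E 0 = Y0 at *
  generalize E (c - μ) = Y1 at *
  generalize E w = Y2 at *
  generalize E (c - (w + μ)) = Y3 at *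
  generalize jacobiTheta₂ μ τ = M at *
  generalize jacobiTheta₂ (c - w) τ = P at *
  generalize jacobiTheta₂ (w + μ) τ = Q at *
  generalize (2 / (Real.pi * I) : ℂ) = K at *
  clear_value D
  field_simp
  linear_combination (K ^ 2 * D ^ 2) * hkey
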